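/- arXiv:2112.00629 — 9 statements merged into one kernel-verified Lean document; each statement's English description precedes it below -/
import Mathlib

section
/- Every finite forest (finite simple acyclic graph) G with vertex set V admits a touching grounded L-shape representation: there exist functions x, x', y : V → ℝ such that x is injective, y is injective, for every vertex v one has y(v) > 0 and x(v) ≤ x'(v), for all distinct vertices u, v with x(u) < x(v) it is not the case that both x(v) < x'(u) and y(u) < y(v) (no two L-shapes cross), and for all distinct vertices u, v with x(u) < x(v), u and v are adjacent in G if and only if x'(u) = x(v) and y(u) < y(v) (two L-shapes touch exactly when the corresponding vertices are adjacent). -/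
open Filter Topology in
/-- Below every real there is a smaller one with no point of a given finite family in between. -/
lemma exists_lt_forall_lt_imp_lt {ι : Type*} (s : Finset ι) (f : ι → ℝ) (a : ℝ) :
    ∃ b < a, ∀ i ∈ s, f i < a → f i < b := by
  have h : ∀ᶠ b in 𝓝[<] a, ∀ i ∈ s, f i < a → f i < b :=
    (Finset.eventually_all s).2 fun i _ ↦ eventually_imp_distrib_left.2 fun hi ↦
      nhdsWithin_le_nhds (lt_mem_nhds hi)
  obtain ⟨b, hb, hba⟩ := (h.and self_mem_nhdsWithin).exists
  exact ⟨b, hba, hb⟩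

/-- A nonempty finite forest has a vertex with at most one neighbour. -/
lemma SimpleGraph.IsAcyclic.exists_forall_adj_eq {V : Type*} [Finite V] [Nonempty V]
    {G : SimpleGraph V} (hG : G.IsAcyclic) : ∃ v p, ∀ w, G.Adj v w → w = p := by
  obtain ⟨u, v, p, hp, hmax⟩ := Walk.exists_isPath_forall_isPath_length_le_length G
  refine ⟨u, p.snd, fun w hadj ↦ hG.eq_snd_of_adj_start hp hadj ?_⟩
  by_contra hw
  have := hmax _ _ _ (hp.cons (h := hadj.symm) hw)
  simp at this

/-- `x`, `x'` and `y` describe a touching grounded L-shape representation of the subgraph of `G`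
induced on `s`. -/
structure SimpleGraph.IsLShapeRepOn {V : Type*} (G : SimpleGraph V) (s : Finset V)
    (x x' y : V → ℝ) : Prop where
  injOn_x : Set.InjOn x s
  injOn_y : Set.InjOn y s
  pos : ∀ v ∈ s, 0 < y v
  le : ∀ v ∈ s, x v ≤ x' v
  not_cross : ∀ u ∈ s, ∀ v ∈ s, x u < x v → ¬(x v < x' u ∧ y u < y v)
  adj_iff : ∀ u ∈ s, ∀ v ∈ s, x u < x v → (G.Adj u v ↔ x' u = x v ∧ y u < y v)

/-- A lowest L-shape may be added to a representation if its horizontal segment passes through no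
vertical segment. -/
lemma SimpleGraph.IsLShapeRepOn.insert {V : Type*} [DecidableEq V] {G : SimpleGraph V}
    {s : Finset V} {x x' y : V → ℝ} (h : G.IsLShapeRepOn s x x' y) {l : V} (hl : l ∉ s)
    {a b : ℝ} (hab : a ≤ b) (ha : ∀ u ∈ s, x u ≠ a) (hb : ∀ u ∈ s, a < x u → b ≤ x u)
    (hadj : ∀ u ∈ s, G.Adj l u ↔ a < x u ∧ b = x u) :
    ∃ x x' y : V → ℝ, G.IsLShapeRepOn (Insert.insert l s) x x' y := by
  obtain ⟨c, hc, hcy⟩ : ∃ c : ℝ, 0 < c ∧ ∀ u ∈ s, c < y u := by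
    obtain ⟨c, hc, hcy⟩ := exists_lt_forall_lt_imp_lt s (fun u ↦ -y u) 0
    exact ⟨-c, by linarith, fun u hu ↦ by linarith [hcy u hu (by linarith [h.pos u hu])]⟩
  have hne : ∀ u ∈ s, u ≠ l := fun u hu hul ↦ hl (hul ▸ hu)
  obtain ⟨h1, h2, h3, h4, h5, h6⟩ := h
  refine ⟨Function.update x l a, Function.update x' l b, Function.update y l c, ?_, ?_, ?_, ?_,
    ?_, ?_⟩
  · intro u hu v hv
    have := @h1 u
    grind
  · intro u hu v hv
    have := @h2 u
    grind
  · grind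
  · grind
  · grind
  · intro u hu v hv
    rcases Finset.mem_insert.1 hu with rfl | hus <;> rcases Finset.mem_insert.1 hv with rfl | hvs
    · simp
    · grind
    · have := hadj u hus
      have := hcy u hus
      rw [G.adj_comm]
      grind
    · grind

lemma SimpleGraph.IsAcyclic.exists_isLShapeRepOn {V : Type*} {G : SimpleGraph V}
    (hG : G.IsAcyclic) (s : Finset V) : ∃ x x' y : V → ℝ, G.IsLShapeRepOn s x x' y := by
  classical
  induction s using Finset.strongInduction with
  | H s ih =>
  obtain rfl | ⟨w, hw⟩ := s.eq_empty_or_nonempty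
  · exact ⟨0, 0, 0, by constructor <;> simp⟩
  have : Nonempty (s : Set V) := ⟨⟨w, hw⟩⟩
  obtain ⟨⟨l, hl⟩, ⟨p, hp⟩, hlp⟩ := (hG.induce (s : Set V)).exists_forall_adj_eq
  replace hlp : ∀ u ∈ s, G.Adj l u → u = p := fun u hu hlu ↦
    congrArg Subtype.val (hlp ⟨u, hu⟩ hlu)
  obtain ⟨x, x', y, h⟩ := ih _ (Finset.erase_ssubset hl)
  rw [← Finset.insert_erase hl]
  have hinj := h.injOn_x
  by_cases hadj : G.Adj l p
  · obtain ⟨a, hap, ha⟩ := exists_lt_forall_lt_imp_lt (s.erase l) x (x p)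
    have hps : p ∈ s.erase l := Finset.mem_erase.2 ⟨hadj.ne', hp⟩
    refine h.insert (Finset.notMem_erase _ _) hap.le (fun u hu hua ↦ ?_) (fun u hu hau ↦ ?_)
      fun u hu ↦ ⟨fun hlu ↦ ?_, fun hu' ↦ ?_⟩
    · linarith [ha u hu (hua ▸ hap)]
    · by_contra! hup
      linarith [ha u hu hup]
    · obtain rfl := hlp u (Finset.mem_of_mem_erase hu) hlu
      exact ⟨hap, rfl⟩
    · rwa [← hinj hps hu hu'.2]
  · obtain ⟨a, ha⟩ := ((s.erase l).image x).exists_le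
    have hlt : ∀ u ∈ s.erase l, x u < a + 1 := fun u hu ↦ by
      linarith [ha _ (Finset.mem_image_of_mem x hu)]
    refine h.insert (Finset.notMem_erase _ _) le_rfl (fun u hu ↦ (hlt u hu).ne)
      (fun u hu hau ↦ hau.le) fun u hu ↦ ⟨fun hlu ↦ ?_, fun hu' ↦ ?_⟩
    · exact absurd (hlp u (Finset.mem_of_mem_erase hu) hlu ▸ hlu) hadj
    · exact absurd hu'.1 (hlt u hu).not_gt

/-- Every finite forest admits a touching grounded L-shape representation. -/
theorem forest_has_touching_grounded_Lshape_representation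
    {V : Type*} [Fintype V] (G : SimpleGraph V) (hG : G.IsAcyclic) :
    ∃ x x' y : V → ℝ,
      Function.Injective x ∧
      Function.Injective y ∧
      (∀ v, 0 < y v ∧ x v ≤ x' v) ∧
      (∀ u v, u ≠ v → x u < x v → ¬(x v < x' u ∧ y u < y v)) ∧
      (∀ u v, u ≠ v → x u < x v → (G.Adj u v ↔ x' u = x v ∧ y u < y v)) := by
  obtain ⟨x, x', y, h⟩ := hG.exists_isLShapeRepOn Finset.univ
  refine ⟨x, x', y, Set.injOn_univ.1 ?_, Set.injOn_univ.1 ?_,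
    fun v ↦ ⟨h.pos v (Finset.mem_univ v), h.le v (Finset.mem_univ v)⟩,
    fun u v _ ↦ h.not_cross u (Finset.mem_univ u) v (Finset.mem_univ v),
    fun u v _ ↦ h.adj_iff u (Finset.mem_univ u) v (Finset.mem_univ v)⟩
  · simpa using h.injOn_x
  · simpa using h.injOn_y
end

section
/- Let G be a finite simple graph with vertex set V, and suppose there exist functions x, x', y : V → ℝ such that x is injective, y is injective, for every vertex v one has y(v) > 0 and x(v) ≤ x'(v), for all distinct vertices u, v with x(u) < x(v) it is not the case that both x(v) < x'(u) and y(u) < y(v), and for all distinct vertices u, v with x(u) < x(v), u and v are adjacent in G if and only if x'(u) = x(v) and y(u) < y(v). Then G is acyclic, i.e., G is a forest. -/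
/-- A graph is acyclic if, for some injective ranking of its vertices, every vertex has at most one
neighbor of larger rank. -/
theorem SimpleGraph.isAcyclic_of_subsingleton_upper_neighbors {V α : Type*} [LinearOrder α]
    (G : SimpleGraph V) (f : V → α) (hf : Function.Injective f)
    (h : ∀ u v w, G.Adj u v → G.Adj u w → f u < f v → f u < f w → v = w) :
    G.IsAcyclic := by
  classical
  intro a c hc
  obtain ⟨m, hm, hmin⟩ := c.support.toFinset.exists_min_image f ⟨a, by simp⟩
  simp only [List.mem_toFinset] at hm hmin
  have hd := hc.rotate hm
  have hlt : ∀ v ∈ (c.rotate m hm).support, G.Adj m v → f m < f v := fun v hv hmv =>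
    (hmin v ((c.mem_support_rotate_iff m hm).mp hv)).lt_of_ne (hf.ne hmv.ne)
  have hs := SimpleGraph.Walk.adj_snd hd.not_nil
  have hp := (SimpleGraph.Walk.adj_penultimate hd.not_nil).symm
  exact hd.snd_ne_penultimate <| h m _ _ hs hp
    (hlt _ ((c.rotate m hm).getVert_mem_support _) hs)
    (hlt _ ((c.rotate m hm).getVert_mem_support _) hp)

/-- A finite graph admitting a touching grounded L-shape representation is a forest. -/
theorem touching_grounded_Lshape_representation_is_forest
    {V : Type*} [Fintype V] (G : SimpleGraph V) (x x' y : V → ℝ)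
    (hx : Function.Injective x)
    (hy : Function.Injective y)
    (hshape : ∀ v, 0 < y v ∧ x v ≤ x' v)
    (hnocross : ∀ u v, u ≠ v → x u < x v → ¬(x v < x' u ∧ y u < y v))
    (hadj : ∀ u v, u ≠ v → x u < x v → (G.Adj u v ↔ x' u = x v ∧ y u < y v)) :
    G.IsAcyclic := by
  exact G.isAcyclic_of_subsingleton_upper_neighbors x hx fun u v w huv huw hv hw =>
    hx <| ((hadj u v huv.ne hv).mp huv).1.symm.trans ((hadj u w huw.ne hw).mp huw).1
end

section
/- Let G be a finite simple graph admitting a linear order < of its vertices such that there are no vertices v1 < v2 < v3 < v4 with v1v3 and v2v4 both edges of G (an order avoiding the pattern P_∅). Then G admits a touching grounded representation by convex sets: there exist a compact convex set S_v ⊆ ℝ × [0, ∞) for each vertex v, with pairwise disjoint interiors, such that each S_v intersects the x-axis ℝ × {0} in exactly one point (g(v), 0), the function g : V → ℝ is strictly increasing with respect to the given order, and two distinct vertices u, v are adjacent in G if and only if S_u ∩ S_v ≠ ∅. -/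
/-- The rectangle with sides of slope `1` and `-1` and bottom corner `(t, 0)`, given by
`t ≤ x + y ≤ r` and `l ≤ x - y ≤ t`. -/
def diagonalRectangle (l t r : ℝ) : Set (ℝ × ℝ) :=
  {p | (t ≤ p.1 + p.2 ∧ p.1 + p.2 ≤ r) ∧ l ≤ p.1 - p.2 ∧ p.1 - p.2 ≤ t}

theorem isCompact_diagonalRectangle (l t r : ℝ) : IsCompact (diagonalRectangle l t r) := by
  refine (isCompact_Icc (a := ((t + l) / 2, (0 : ℝ)))
    (b := ((r + t) / 2, (r - l) / 2))).of_isClosed_subset ?_ ?_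
  · refine (IsClosed.and ?_ ?_).and (IsClosed.and ?_ ?_) <;>
      exact isClosed_le (by fun_prop) (by fun_prop)
  · rintro ⟨x, y⟩ ⟨⟨h1, h2⟩, h3, h4⟩
    simp only at h1 h2 h3 h4
    refine ⟨⟨?_, ?_⟩, ?_, ?_⟩ <;> simp only <;> linarith

theorem convex_diagonalRectangle (l t r : ℝ) : Convex ℝ (diagonalRectangle l t r) := by
  have hadd : IsLinearMap ℝ fun p : ℝ × ℝ => p.1 + p.2 :=
    (LinearMap.fst ℝ ℝ ℝ + LinearMap.snd ℝ ℝ ℝ).isLinear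
  have hsub : IsLinearMap ℝ fun p : ℝ × ℝ => p.1 - p.2 :=
    (LinearMap.fst ℝ ℝ ℝ - LinearMap.snd ℝ ℝ ℝ).isLinear
  exact ((convex_halfSpace_ge hadd t).inter (convex_halfSpace_le hadd r)).inter
    ((convex_halfSpace_ge hsub l).inter (convex_halfSpace_le hsub t))

theorem snd_nonneg_of_mem_diagonalRectangle {l t r : ℝ} {p : ℝ × ℝ}
    (hp : p ∈ diagonalRectangle l t r) : 0 ≤ p.2 := by
  obtain ⟨⟨h1, -⟩, -, h2⟩ := hp
  linarith

theorem diagonalRectangle_ground {l t r : ℝ} (hl : l ≤ t) (hr : t ≤ r) :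
    {p : ℝ × ℝ | p ∈ diagonalRectangle l t r ∧ p.2 = 0} = {(t, (0 : ℝ))} := by
  ext ⟨x, y⟩
  simp only [diagonalRectangle, Set.mem_ofPred_eq, Set.mem_singleton_iff, Prod.mk.injEq]
  constructor
  · rintro ⟨⟨⟨h1, -⟩, -, h2⟩, rfl⟩
    exact ⟨by linarith, rfl⟩
  · rintro ⟨rfl, rfl⟩
    simp [hl, hr]

theorem interior_eq_empty_of_subset_line {s : Set (ℝ × ℝ)} {k c : ℝ}
    (hs : ∀ p ∈ s, p.1 + k * p.2 = c) : interior s = ∅ := by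
  refine Set.eq_empty_iff_forall_notMem.2 fun p hp => ?_
  have hcont : Continuous fun ε : ℝ => (p.1 + ε, p.2) := by fun_prop
  have hev : ∀ᶠ ε in nhdsWithin (0 : ℝ) (Set.Ioi 0), (p.1 + ε, p.2) ∈ s :=
    nhdsWithin_le_nhds (hcont.tendsto 0 (by simpa using mem_interior_iff_mem_nhds.1 hp))
  obtain ⟨ε, hε, hpos⟩ := (hev.and self_mem_nhdsWithin).exists
  have h0 := hs p (interior_subset hp)
  have h1 := hs _ hε
  simp only at hpos h1
  linarith

theorem interior_diagonalRectangle_inter {l₁ t₁ r₁ l₂ t₂ r₂ : ℝ} (h : r₁ ≤ t₂ ∨ t₁ ≤ l₂) :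
    interior (diagonalRectangle l₁ t₁ r₁) ∩ interior (diagonalRectangle l₂ t₂ r₂) = ∅ := by
  rw [← interior_inter]
  rcases h with h | h
  · refine interior_eq_empty_of_subset_line (k := 1) (c := t₂) ?_
    rintro p ⟨⟨⟨-, h1⟩, -⟩, ⟨h2, -⟩, -⟩
    linarith
  · refine interior_eq_empty_of_subset_line (k := -1) (c := t₁) ?_
    rintro p ⟨⟨-, -, h1⟩, -, h2, -⟩
    linarith

theorem diagonalRectangle_inter_nonempty_iff {l₁ t₁ r₁ l₂ t₂ r₂ : ℝ} (ht : t₁ ≤ t₂)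
    (hl : l₁ ≤ t₁) (hr : t₂ ≤ r₂) :
    (diagonalRectangle l₁ t₁ r₁ ∩ diagonalRectangle l₂ t₂ r₂).Nonempty ↔ t₂ ≤ r₁ ∧ l₂ ≤ t₁ := by
  constructor
  · rintro ⟨p, ⟨⟨-, h1⟩, -, h2⟩, ⟨h3, -⟩, h4, -⟩
    exact ⟨h3.trans h1, h4.trans h2⟩
  · rintro ⟨h1, h2⟩
    refine ⟨((t₂ + t₁) / 2, (t₂ - t₁) / 2), ⟨⟨?_, ?_⟩, ?_, ?_⟩, ⟨?_, ?_⟩, ?_, ?_⟩ <;>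
      simp only <;> linarith

theorem Fintype.exists_strictMono_real (V : Type*) [Fintype V] [LinearOrder V] :
    ∃ g : V → ℝ, StrictMono g :=
  ⟨fun v => ((Fintype.orderIsoFinOfCardEq V rfl).symm v : ℕ), fun _ _ h =>
    Nat.cast_lt.2 ((Fintype.orderIsoFinOfCardEq V rfl).symm.strictMono h)⟩

theorem SimpleGraph.exists_greatest_neighbor {V : Type*} [Finite V] [LinearOrder V]
    (G : SimpleGraph V) (v : V) :
    ∃ r, v ≤ r ∧ (r = v ∨ G.Adj v r) ∧ ∀ w, G.Adj v w → w ≤ r := by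
  obtain ⟨r, hr, hmax⟩ := Set.exists_max_image (insert v (G.neighborSet v)) id
    (Set.toFinite _) (Set.insert_nonempty _ _)
  exact ⟨r, hmax v (Set.mem_insert _ _), hr, fun w hw => hmax w (Set.mem_insert_of_mem _ hw)⟩

theorem SimpleGraph.exists_least_neighbor {V : Type*} [Finite V] [LinearOrder V]
    (G : SimpleGraph V) (v : V) :
    ∃ l, l ≤ v ∧ (l = v ∨ G.Adj v l) ∧ ∀ w, G.Adj v w → l ≤ w :=
  SimpleGraph.exists_greatest_neighbor (V := Vᵒᵈ) G v

/-- A finite graph with a vertex order avoiding the pattern `P_∅` admits a touching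
grounded representation by convex sets. -/
theorem avoids_Pempty_has_touching_grounded_convex_representation
    {V : Type*} [Fintype V] [LinearOrder V] (G : SimpleGraph V)
    (havoid : ∀ v1 v2 v3 v4 : V, v1 < v2 → v2 < v3 → v3 < v4 →
      G.Adj v1 v3 → G.Adj v2 v4 → False) :
    ∃ (S : V → Set (ℝ × ℝ)) (g : V → ℝ),
      (∀ v, IsCompact (S v)) ∧
      (∀ v, Convex ℝ (S v)) ∧
      (∀ v, ∀ p ∈ S v, 0 ≤ p.2) ∧
      (∀ u v, u ≠ v → interior (S u) ∩ interior (S v) = ∅) ∧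
      (∀ v, {p : ℝ × ℝ | p ∈ S v ∧ p.2 = 0} = {((g v : ℝ), (0 : ℝ))}) ∧
      StrictMono g ∧
      (∀ u v, u ≠ v → (G.Adj u v ↔ (S u ∩ S v).Nonempty)) := by
  obtain ⟨g, hg⟩ := Fintype.exists_strictMono_real V
  choose r hr hradj hrmax using G.exists_greatest_neighbor
  choose l hl hladj hlmin using G.exists_least_neighbor
  have hcross : ∀ u v, u < v → r u ≤ v ∨ u ≤ l v := by
    intro u v huv
    by_contra! h
    have hu : G.Adj u (r u) := (hradj u).resolve_left (huv.trans h.1).ne'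
    have hv : G.Adj v (l v) := (hladj v).resolve_left (h.2.trans huv).ne
    exact havoid _ _ _ _ h.2 huv h.1 hv.symm hu
  have hadj : ∀ u v, u < v → (G.Adj u v ↔ v ≤ r u ∧ l v ≤ u) := by
    refine fun u v huv => ⟨fun h => ⟨hrmax u v h, hlmin v u h.symm⟩, fun ⟨h1, h2⟩ => ?_⟩
    rcases hcross u v huv with h | h
    · obtain rfl := h.antisymm h1
      exact (hradj u).resolve_left huv.ne'
    · obtain rfl := h.antisymm h2
      exact ((hladj v).resolve_left huv.ne).symm
  refine ⟨fun v => diagonalRectangle (g (l v)) (g v) (g (r v)), g,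
    fun v => isCompact_diagonalRectangle _ _ _, fun v => convex_diagonalRectangle _ _ _,
    fun v p hp => snd_nonneg_of_mem_diagonalRectangle hp, ?_,
    fun v => diagonalRectangle_ground (hg.monotone (hl v)) (hg.monotone (hr v)), hg, ?_⟩
  · have hlt : ∀ u v, u < v → interior (diagonalRectangle (g (l u)) (g u) (g (r u))) ∩
        interior (diagonalRectangle (g (l v)) (g v) (g (r v))) = ∅ := fun u v huv =>
      interior_diagonalRectangle_inter
        ((hcross u v huv).imp (fun h => hg.monotone h) fun h => hg.monotone h)
    intro u v huv
    rcases huv.lt_or_gt with h | h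
    · exact hlt u v h
    · rw [Set.inter_comm]
      exact hlt v u h
  · have hlt : ∀ u v, u < v → (G.Adj u v ↔ (diagonalRectangle (g (l u)) (g u) (g (r u)) ∩
        diagonalRectangle (g (l v)) (g v) (g (r v))).Nonempty) := fun u v huv => by
      rw [diagonalRectangle_inter_nonempty_iff (hg huv).le (hg.monotone (hl u))
        (hg.monotone (hr v)), hg.le_iff_le, hg.le_iff_le, hadj u v huv]
    intro u v huv
    rcases huv.lt_or_gt with h | h
    · exact hlt u v h
    · rw [G.adj_comm, Set.inter_comm]
      exact hlt v u h
end

section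
/- Let G be a finite simple graph admitting a linear order < of its vertices avoiding the pattern P_a, i.e., such that there are no vertices v1 < v2 < v3 < v4 with v1v3 and v2v4 edges of G while v1v2 is a non-edge of G. Then G admits an interval filament representation: there exist reals α(v) < β(v) for each vertex v, with all 2|V| values {α(v)} ∪ {β(v)} pairwise distinct and α strictly increasing with respect to the given order, and continuous curves f_v : [0,1] → ℝ × [0, ∞) with f_v(0) = (α(v), 0), f_v(1) = (β(v), 0), with the second coordinate of f_v(t) strictly positive for all t ∈ (0,1), such that two distinct vertices u, v are adjacent in G if and only if the images of f_u and f_v intersect. -/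
/-- The bump of height at most `1` on `[a, b]`, plus a spike of height `c` at `a + 1 / 4`. -/
noncomputable def spikedBump (c a b x : ℝ) : ℝ :=
  max 0 (min 1 (min (x - a) (b - x))) + c * max 0 (1 - 4 * |x - (a + 1 / 4)|)

lemma continuous_spikedBump (c a b : ℝ) : Continuous (spikedBump c a b) := by
  unfold spikedBump
  fun_prop

lemma spikedBump_nonneg {c : ℝ} (hc : 0 ≤ c) (a b x : ℝ) : 0 ≤ spikedBump c a b x := by
  unfold spikedBump
  positivity

lemma spikedBump_pos {c a b x : ℝ} (hc : 0 ≤ c) (ha : a < x) (hb : x < b) :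
    0 < spikedBump c a b x := by
  have h : 0 < min 1 (min (x - a) (b - x)) :=
    lt_min one_pos (lt_min (sub_pos.2 ha) (sub_pos.2 hb))
  exact add_pos_of_pos_of_nonneg (lt_max_of_lt_right h) (by positivity)

lemma spikedBump_le_one {c a b x : ℝ} (hx : 1 / 4 ≤ |x - (a + 1 / 4)|) :
    spikedBump c a b x ≤ 1 := by
  have h : max 0 (1 - 4 * |x - (a + 1 / 4)|) = 0 := max_eq_left (by linarith)
  rw [spikedBump, h, mul_zero, add_zero]
  exact max_le zero_le_one (min_le_left _ _)

lemma spikedBump_eq_zero {c a b x : ℝ} (hab : a + 1 / 2 < b) (hx : x ≤ a ∨ b ≤ x) :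
    spikedBump c a b x = 0 := by
  have h₁ : max 0 (1 - 4 * |x - (a + 1 / 4)|) = 0 := by
    refine max_eq_left ?_
    rcases hx with hx | hx
    · linarith [neg_le_abs (x - (a + 1 / 4))]
    · linarith [le_abs_self (x - (a + 1 / 4))]
  have h₂ : max 0 (min 1 (min (x - a) (b - x))) = 0 := by
    refine max_eq_left ((min_le_right _ _).trans ?_)
    rcases hx with hx | hx
    · exact (min_le_left _ _).trans (by linarith)
    · exact (min_le_right _ _).trans (by linarith)
  rw [spikedBump, h₁, h₂, mul_zero, add_zero]

lemma le_spikedBump_spike (c a b : ℝ) : c ≤ spikedBump c a b (a + 1 / 4) := by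
  simp [spikedBump]

/-- Intervals whose overlap pattern is compatible with `G`, together with a transitive relation
`R` between nested non-adjacent intervals, are the supports of filaments representing `G`; the
filaments may be taken to be graphs of functions. -/
theorem exists_filaments_of_nesting {V : Type*} [Fintype V] (G : SimpleGraph V)
    (α β : V → ℝ) (R : V → V → Prop)
    (hlen : ∀ v, α v + 1 / 2 < β v)
    (hsep : ∀ u v, u ≠ v → 1 / 2 ≤ |α u - α v|)
    (htrans : ∀ u v w, R u v → R v w → R u w)
    (hnest : ∀ u v, R u v → α u < α v ∧ β v < β u)
    (hadj : ∀ u v, G.Adj u v → α u < β v ∧ ¬ R u v)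
    (hnonadj : ∀ u v, u ≠ v → ¬ G.Adj u v → β u < α v ∨ β v < α u ∨ R u v ∨ R v u) :
    ∃ F : V → ℝ → ℝ,
      (∀ v, Continuous (F v)) ∧ (∀ v, F v (α v) = 0) ∧ (∀ v, F v (β v) = 0) ∧
      (∀ v, ∀ x ∈ Set.Ioo (α v) (β v), 0 < F v x) ∧
      ∀ u v, u ≠ v → (G.Adj u v ↔
        ∃ x ∈ Set.Icc (α u) (β u) ∩ Set.Icc (α v) (β v), F u x = F v x) := by
  classical
  set c : ℝ := (Fintype.card V : ℝ) with hc
  have hc0 : 0 ≤ c := by positivity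
  let g : V → ℝ → ℝ := fun w => spikedBump c (α w) (β w)
  let S : V → Finset V := fun v => {w | w = v ∨ R v w}
  let F : V → ℝ → ℝ := fun v x => ∑ w ∈ S v, g w x
  have hS : ∀ v w, w ∈ S v ↔ w = v ∨ R v w := fun v w => by simp [S]
  have hg0 : ∀ w x, 0 ≤ g w x := fun w x => spikedBump_nonneg hc0 _ _ _
  have hleF : ∀ v x, g v x ≤ F v x := fun v x =>
    Finset.single_le_sum (f := fun w => g w x) (fun w _ => hg0 w x) ((hS v v).2 (Or.inl rfl))
  have hpos : ∀ v, ∀ x ∈ Set.Ioo (α v) (β v), 0 < F v x := fun v x hx =>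
    (spikedBump_pos hc0 hx.1 hx.2).trans_le (hleF v x)
  have hcont : ∀ v, Continuous (F v) := fun v =>
    continuous_finsetSum _ fun w _ => continuous_spikedBump _ _ _
  have hα : ∀ v, F v (α v) = 0 := fun v => Finset.sum_eq_zero fun w hw => by
    refine spikedBump_eq_zero (hlen w) (Or.inl ?_)
    rcases (hS v w).1 hw with rfl | h
    · exact le_rfl
    · exact (hnest _ _ h).1.le
  have hβ : ∀ v, F v (β v) = 0 := fun v => Finset.sum_eq_zero fun w hw => by
    refine spikedBump_eq_zero (hlen w) (Or.inr ?_)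
    rcases (hS v w).1 hw with rfl | h
    · exact le_rfl
    · exact (hnest _ _ h).2.le
  have hlt : ∀ u v, R u v → ∀ x ∈ Set.Icc (α v) (β v), F v x < F u x := by
    intro u v huv x hx
    have hn := hnest u v huv
    have hu : u ∉ S v := fun h => by
      rcases (hS v u).1 h with rfl | h
      · exact lt_irrefl _ hn.1
      · exact lt_asymm hn.1 (hnest _ _ h).1
    have hsub : insert u (S v) ⊆ S u := fun w hw => by
      rcases Finset.mem_insert.1 hw with rfl | hw
      · exact (hS _ _).2 (Or.inl rfl)
      · rcases (hS v w).1 hw with rfl | h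
        · exact (hS _ _).2 (Or.inr huv)
        · exact (hS _ _).2 (Or.inr (htrans _ _ _ huv h))
    have hle : ∑ w ∈ insert u (S v), g w x ≤ F u x :=
      Finset.sum_le_sum_of_subset_of_nonneg hsub fun w _ _ => hg0 w x
    rw [Finset.sum_insert hu] at hle
    have : 0 < g u x := spikedBump_pos hc0 (hn.1.trans_le hx.1) (hx.2.trans_lt hn.2)
    exact (lt_add_of_pos_left _ this).trans_le hle
  have hspike : ∀ u v, u ≠ v → ¬ R u v → F u (α v + 1 / 4) ≤ F v (α v + 1 / 4) := by
    intro u v huv hR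
    refine le_trans ?_ ((le_spikedBump_spike c (α v) (β v)).trans (hleF v _))
    have h1 : ∀ w ∈ S u, g w (α v + 1 / 4) ≤ 1 := fun w hw => by
      have hwv : v ≠ w := by
        rintro rfl
        rcases (hS u v).1 hw with h | h
        · exact huv h.symm
        · exact hR h
      refine spikedBump_le_one ?_
      rw [add_sub_add_right_eq_sub]
      linarith [hsep v w hwv]
    refine (Finset.sum_le_card_nsmul _ _ 1 h1).trans ?_
    rw [nsmul_eq_mul, mul_one, hc]
    exact_mod_cast Finset.card_le_univ _
  have hcross : ∀ u v, G.Adj u v → α u < α v →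
      ∃ x ∈ Set.Icc (α u) (β u) ∩ Set.Icc (α v) (β v), F u x = F v x := by
    intro u v huv hlt'
    have hvu := (hadj v u huv.symm).1
    -- The crossing is sought in `[α v, min (α v + 1 / 4) (β u)]`.
    have hend : F u (min (α v + 1 / 4) (β u)) ≤ F v (min (α v + 1 / 4) (β u)) := by
      rcases le_total (α v + 1 / 4) (β u) with h | h
      · rw [min_eq_left h]
        exact hspike u v huv.ne (hadj u v huv).2
      · rw [min_eq_right h, hβ]
        exact Finset.sum_nonneg fun w _ => hg0 w _
    have hstart : F v (α v) ≤ F u (α v) := by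
      rw [hα]
      exact Finset.sum_nonneg fun w _ => hg0 w _
    have hle : α v ≤ min (α v + 1 / 4) (β u) := le_min (by linarith) hvu.le
    obtain ⟨x, hx, hFx⟩ := isPreconnected_Icc.intermediate_value₂
      (Set.left_mem_Icc.2 hle) (Set.right_mem_Icc.2 hle)
      (hcont v).continuousOn (hcont u).continuousOn hstart hend
    have h1 := hx.2.trans (min_le_left _ _)
    have h2 := hx.2.trans (min_le_right _ _)
    exact ⟨x, ⟨⟨hlt'.le.trans hx.1, h2⟩, hx.1, by linarith [hlen v]⟩, hFx.symm⟩
  refine ⟨F, hcont, hα, hβ, hpos, fun u v huv => ⟨fun h => ?_, ?_⟩⟩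
  · rcases lt_trichotomy (α u) (α v) with h' | h' | h'
    · exact hcross u v h h'
    · have := hsep u v huv
      norm_num [h'] at this
    · obtain ⟨x, hx, hF⟩ := hcross v u h.symm h'
      exact ⟨x, hx.symm, hF.symm⟩
  · rintro ⟨x, ⟨hxu, hxv⟩, hF⟩
    by_contra h
    rcases hnonadj u v huv h with h | h | h | h
    · linarith [hxu.2, hxv.1]
    · linarith [hxv.2, hxu.1]
    · exact (hlt u v h x hxv).ne' hF
    · exact (hlt v u h x hxu).ne hF


/-- A finite graph with a vertex order avoiding the pattern `P_a` admits an
interval filament representation. -/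
theorem avoids_Pa_has_interval_filament_representation
    {V : Type*} [Fintype V] [LinearOrder V] (G : SimpleGraph V)
    (havoid : ∀ v1 v2 v3 v4 : V, v1 < v2 → v2 < v3 → v3 < v4 →
      G.Adj v1 v3 → G.Adj v2 v4 → ¬G.Adj v1 v2 → False) :
    ∃ (α β : V → ℝ) (f : V → ℝ → ℝ × ℝ),
      (∀ v, α v < β v) ∧
      Function.Injective α ∧
      Function.Injective β ∧
      (∀ u v, α u ≠ β v) ∧
      StrictMono α ∧
      (∀ v, ContinuousOn (f v) (Set.Icc 0 1)) ∧
      (∀ v, ∀ t ∈ Set.Icc (0 : ℝ) 1, 0 ≤ (f v t).2) ∧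
      (∀ v, f v 0 = (α v, 0)) ∧
      (∀ v, f v 1 = (β v, 0)) ∧
      (∀ v, ∀ t ∈ Set.Ioo (0 : ℝ) 1, 0 < (f v t).2) ∧
      (∀ u v, u ≠ v →
        (G.Adj u v ↔ (f u '' Set.Icc 0 1 ∩ f v '' Set.Icc 0 1).Nonempty)) := by
  classical
  have hreach : ∀ v, ∃ m, v ≤ m ∧ (m = v ∨ G.Adj v m) ∧ ∀ w, G.Adj v w → w ≤ m := by
    intro v
    obtain ⟨m, hm, hmax⟩ := Finset.exists_max_image (Finset.univ.filter fun w => w = v ∨ G.Adj v w)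
      id ⟨v, by simp⟩
    simp only [Finset.mem_filter, Finset.mem_univ, true_and, id] at hm hmax
    exact ⟨m, hmax v (Or.inl rfl), hm, fun w hw => hmax w (Or.inr hw)⟩
  choose m hvm hm hmmax using hreach
  let e := Fintype.orderIsoFinOfCardEq V rfl
  let k : V → ℕ := fun v => e.symm v
  have hk : StrictMono k := fun u v h => e.symm.strictMono h
  have hkn : ∀ v, k v < Fintype.card V := fun v => (e.symm v).isLt
  let ε : V → ℝ := fun v => 1 / 2 * ((k v + 1) / (Fintype.card V + 1))
  have hε0 : ∀ v, 0 < ε v := fun v => by positivity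
  have hε1 : ∀ v, ε v < 1 / 2 := fun v => by
    have h : ((k v : ℝ) + 1) / (Fintype.card V + 1) < 1 := by
      rw [div_lt_one (by positivity)]
      exact_mod_cast Nat.succ_lt_succ (hkn v)
    simp only [ε]
    linarith
  have hεmono : StrictMono ε := fun u v h => by
    have : (k u : ℝ) < k v := by exact_mod_cast hk h
    simp only [ε]
    gcongr
  let α : V → ℝ := fun v => k v
  have hα : StrictMono α := fun u v h => Nat.cast_lt.2 (hk h)
  have hα1 : ∀ {u v}, u < v → α u + 1 ≤ α v := fun {u v} h => by
    have : (k u : ℝ) + 1 ≤ k v := by exact_mod_cast Nat.succ_le_of_lt (hk h)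
    exact this
  let β : V → ℝ := fun v => α (m v) + 1 - ε v
  have hβlt : ∀ {u v}, m u < v → β u < α v := fun {u v} h => by
    simp only [β]
    linarith [hα1 h, hε0 u]
  have hltβ : ∀ {u v}, u ≤ m v → α u + 1 / 2 < β v := fun {u v} h => by
    simp only [β]
    linarith [hα.monotone h, hε1 v]
  have hββ : ∀ {u v}, m u < m v → β u < β v := fun {u v} h =>
    (hβlt h).trans (by linarith [hltβ (le_refl (m v))])
  have hββ' : ∀ {u v}, m u = m v → u < v → β v < β u := fun {u v} h h' => by
    simp only [β, h]
    linarith [hεmono h']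
  have hαβ : ∀ v, α v < β v := fun v => by linarith [hltβ (hvm v)]
  let R : V → V → Prop := fun u v => u < v ∧ ¬ G.Adj u v ∧ v < m u
  have hmm : ∀ u v, R u v → m v ≤ m u := by
    rintro u v ⟨huv, hn, hv⟩
    by_contra! h
    have hu : G.Adj u (m u) := (hm u).resolve_left (huv.trans hv).ne'
    have hv' : G.Adj v (m v) := (hm v).resolve_left (hv.trans h).ne'
    exact havoid u v (m u) (m v) huv hv h hu hv' hn
  have hβinj : Function.Injective β := fun u v h => by
    rcases lt_trichotomy (m u) (m v) with h' | h' | h'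
    · exact absurd h (hββ h').ne
    · rcases lt_trichotomy u v with h'' | h'' | h''
      · exact absurd h (hββ' h' h'').ne'
      · exact h''
      · exact absurd h (hββ' h'.symm h'').ne
    · exact absurd h (hββ h').ne'
  have hne : ∀ u v, α u ≠ β v := fun u v => by
    rcases le_or_gt u (m v) with h | h
    · exact (by linarith [hltβ h] : α u < β v).ne
    · exact (hβlt h).ne'
  obtain ⟨F, hcont, hFα, hFβ, hFpos, hFadj⟩ := exists_filaments_of_nesting G α β R
    (fun v => hltβ (hvm v))
    (fun u v huv => by
      rcases lt_or_gt_of_ne huv with h | h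
      · linarith [hα1 h, neg_le_abs (α u - α v)]
      · linarith [hα1 h, le_abs_self (α u - α v)])
    (fun u v w huv hvw => by
      refine ⟨huv.1.trans hvw.1, fun h => ?_, hvw.2.2.trans_le (hmm u v huv)⟩
      have hv : G.Adj v (m v) := (hm v).resolve_left (hvw.1.trans hvw.2.2).ne'
      exact havoid u v w (m v) huv.1 hvw.1 hvw.2.2 h hv huv.2.1)
    (fun u v huv => by
      refine ⟨hα huv.1, ?_⟩
      rcases (hmm u v huv).lt_or_eq with h | h
      · exact hββ h
      · exact hββ' h.symm huv.1)
    (fun u v huv => ⟨by linarith [hltβ (hmmax v u huv.symm)], fun h => h.2.1 huv⟩)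
    (fun u v huv hn => by
      have key : ∀ u v, u < v → ¬ G.Adj u v → β u < α v ∨ R u v := fun u v h hn => by
        rcases lt_trichotomy (m u) v with h' | h' | h'
        · exact Or.inl (hβlt h')
        · rcases hm u with h'' | h''
          · exact absurd (h''.symm.trans h') h.ne
          · exact absurd (h' ▸ h'') hn
        · exact Or.inr ⟨h, hn, h'⟩
      rcases lt_or_gt_of_ne huv with h | h
      · have := key u v h hn
        tauto
      · have := key v u h fun h => hn h.symm
        tauto)
  have himage : ∀ v, (fun t => AffineMap.lineMap (α v) (β v) t) '' Set.Icc (0 : ℝ) 1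
      = Set.Icc (α v) (β v) := fun v => by
    rw [← segment_eq_image_lineMap, segment_eq_Icc (hαβ v).le]
  have hpos : ∀ v, ∀ t ∈ Set.Ioo (0 : ℝ) 1, 0 < F v (AffineMap.lineMap (α v) (β v) t) :=
    fun v t ht => hFpos v _ ⟨(left_lt_lineMap_iff_lt (k := ℝ) ht.1).2 (hαβ v),
      (lineMap_lt_right_iff_lt (k := ℝ) ht.2).2 (hαβ v)⟩
  refine ⟨α, β, fun v t => (AffineMap.lineMap (α v) (β v) t, F v (AffineMap.lineMap (α v) (β v) t)),
    hαβ, hα.injective, hβinj, hne, hα, fun v => ?_, fun v t ht => ?_, fun v => by simp [hFα],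
    fun v => by simp [hFβ], hpos, fun u v huv => ?_⟩
  · have h : Continuous fun t : ℝ => AffineMap.lineMap (α v) (β v) t :=
      AffineMap.lineMap_continuous
    exact (h.prodMk ((hcont v).comp h)).continuousOn
  · rcases ht.1.eq_or_lt with rfl | h0
    · simp [hFα]
    · rcases ht.2.eq_or_lt with rfl | h1
      · simp [hFβ]
      · exact (hpos v t ⟨h0, h1⟩).le
  · rw [hFadj u v huv]
    constructor
    · rintro ⟨x, ⟨hxu, hxv⟩, hF⟩
      rw [← himage] at hxu hxv
      obtain ⟨s, hs, hsx⟩ := hxu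
      obtain ⟨t, ht, htx⟩ := hxv
      dsimp only at hsx htx
      exact ⟨(x, F u x), ⟨s, hs, by simp only [hsx]⟩, t, ht, by simp only [htx, hF]⟩
    · rintro ⟨p, ⟨s, hs, rfl⟩, t, ht, hp⟩
      obtain ⟨h1, h2⟩ := Prod.ext_iff.1 hp
      dsimp only at h1 h2
      refine ⟨AffineMap.lineMap (α u) (β u) s, ⟨?_, ?_⟩, by rw [← h2, h1]⟩
      · exact himage u ▸ ⟨s, hs, rfl⟩
      · exact himage v ▸ ⟨t, ht, h1⟩
end

section
/- Let G be a finite simple graph admitting a linear order < of its vertices avoiding the pattern P_{ab}, i.e., such that there are no vertices v1 < v2 < v3 < v4 with v1v3 and v2v4 edges of G while v1v2 and v2v3 are non-edges of G. Then G admits a grounded stairs representation: there exist an injective function g : V → ℝ, strictly increasing with respect to the given order, and for each vertex v a continuous curve γ_v : [0,1] → ℝ × [0, ∞) whose two coordinate functions are both monotone nondecreasing, with γ_v(0) = (g(v), 0), such that no point of the x-axis belongs to the images of two distinct curves, and two distinct vertices u, v are adjacent in G if and only if the images of γ_u and γ_v intersect. -/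
/-- The piecewise linear interpolation on `[0, M]` of the values `a 0, …, a M` at the integers. -/
noncomputable def interp (M : ℕ) (a : ℕ → ℝ) (s : ℝ) : ℝ :=
  a 0 + ∑ h ∈ Finset.range M, (a (h + 1) - a h) * max 0 (min 1 (s - h))

theorem interp_continuous (M : ℕ) (a : ℕ → ℝ) : Continuous (interp M a) := by
  unfold interp
  fun_prop

theorem interp_monotone (M : ℕ) {a : ℕ → ℝ} (ha : Monotone a) : Monotone (interp M a) := by
  intro s t hst
  unfold interp
  gcongr with h
  exact sub_nonneg.2 (ha (Nat.le_succ h))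

theorem interp_add {M k : ℕ} (hk : k < M) (a : ℕ → ℝ) {θ : ℝ} (h0 : 0 ≤ θ) (h1 : θ ≤ 1) :
    interp M a (k + θ) = (1 - θ) * a k + θ * a (k + 1) := by
  unfold interp
  induction M, hk using Nat.le_induction with
  | base =>
    rw [Finset.sum_range_succ]
    have hsum : ∑ h ∈ Finset.range k, (a (h + 1) - a h) * max 0 (min 1 ((k : ℝ) + θ - h)) =
        ∑ h ∈ Finset.range k, (a (h + 1) - a h) := by
      refine Finset.sum_congr rfl fun h hh => ?_
      have : (h : ℝ) + 1 ≤ k := by exact_mod_cast Finset.mem_range.1 hh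
      rw [min_eq_left (by linarith), max_eq_right zero_le_one, mul_one]
    rw [hsum, Finset.sum_range_sub, add_sub_cancel_left, min_eq_right h1, max_eq_right h0]
    ring
  | succ M hM ih =>
    have : (k : ℝ) + 1 ≤ M := by exact_mod_cast hM
    rw [Finset.sum_range_succ, max_eq_left ((min_le_right _ _).trans (by linarith)), mul_zero,
      add_zero, ih]

theorem interp_natCast {M k : ℕ} (hk : k < M) (a : ℕ → ℝ) : interp M a k = a k := by
  simpa using interp_add hk a le_rfl zero_le_one

theorem interp_lt_interp {M L : ℕ} (hL : L < M) {a b : ℕ → ℝ} (hab : ∀ h ≤ L, a h < b h)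
    {s : ℝ} (hs : 0 ≤ s) (hsL : s ≤ L) : interp M a s < interp M b s := by
  have hk : ⌊s⌋₊ ≤ L := Nat.floor_le_of_le hsL
  have h0 : 0 ≤ s - ⌊s⌋₊ := sub_nonneg.2 (Nat.floor_le hs)
  have h1 : s - ⌊s⌋₊ < 1 := by linarith [Nat.lt_floor_add_one s]
  have hsplit : s = ⌊s⌋₊ + (s - ⌊s⌋₊) := by ring
  rw [hsplit, interp_add (hk.trans_lt hL) a h0 h1.le, interp_add (hk.trans_lt hL) b h0 h1.le]
  refine add_lt_add_of_lt_of_le (mul_lt_mul_of_pos_left (hab _ hk) (by linarith)) ?_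
  rcases h0.eq_or_lt with h | h
  · simp [← h]
  · have : ⌊s⌋₊ < L := by
      have : ((⌊s⌋₊ : ℕ) : ℝ) < L := by linarith
      exact_mod_cast this
    exact mul_le_mul_of_nonneg_left (hab _ this).le h0

/-- A discrete sweep: `x h v` is the position of the vertex `v` at height `h`, and `v` lives up to
height `L v`. -/
theorem exists_sweep_of_avoids {V : Type*} [Fintype V] [LinearOrder V] (G : SimpleGraph V)
    (havoid : ∀ v1 v2 v3 v4 : V, v1 < v2 → v2 < v3 → v3 < v4 →
      G.Adj v1 v3 → G.Adj v2 v4 → ¬G.Adj v1 v2 → ¬G.Adj v2 v3 → False) :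
    ∃ (x : ℕ → V → ℕ) (L : V → ℕ),
      (∀ v, Monotone fun h => x h v) ∧ StrictMono (x 0) ∧
      (∀ h u v, h ≤ L u → h ≤ L v → u < v → ¬G.Adj u v → x h u < x h v) ∧
      (∀ u v, u < v → G.Adj u v → ∃ h, h ≤ L u ∧ h ≤ L v ∧ x h u = x h v) := by
  classical
  rcases isEmpty_or_nonempty V with hV | hV
  · exact ⟨fun _ _ => 0, fun _ => 0, isEmptyElim, isEmptyElim, fun _ => isEmptyElim, isEmptyElim⟩
  obtain ⟨i, hi, N, hN⟩ : ∃ i : V → ℕ, StrictMono i ∧ ∃ N, ∀ v, i v ≤ N :=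
    ⟨fun v => (monoEquivOfFin V rfl).symm v,
      fun _ _ h => (monoEquivOfFin V rfl).symm.strictMono h,
      Fintype.card V, fun v => ((monoEquivOfFin V rfl).symm v).2.le⟩
  obtain ⟨K, hK, p, hp⟩ : ∃ K, 0 < K ∧ ∃ p : ℕ → V × V, ∀ q, ∃ c < K, p c = q := by
    refine ⟨Fintype.card (V × V), Fintype.card_pos,
      fun c => if h : c < _ then (Fintype.equivFin (V × V)).symm ⟨c, h⟩ else Classical.arbitrary _,
      fun q => ⟨Fintype.equivFin (V × V) q, (Fintype.equivFin (V × V) q).2, ?_⟩⟩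
    exact (dif_pos (Fintype.equivFin (V × V) q).2).trans (Equiv.symm_apply_apply _ q)
  let r : V → ℕ := fun w => (Finset.univ.filter fun z => z = w ∨ G.Adj w z).sup i
  have r_self (w : V) : i w ≤ r w := Finset.le_sup (f := i) (by simp)
  have r_adj {w z : V} (h : G.Adj w z) : i z ≤ r w := Finset.le_sup (f := i) (by simp [h])
  have r_lt {u m v : V} (hum : u < m) (hmv : m < v) (huv : G.Adj u v) (h1 : ¬G.Adj u m)
      (h2 : ¬G.Adj m v) : r m < i v := by
    refine (Finset.sup_lt_iff ((Nat.zero_le _).trans_lt (hi hmv))).2 fun z hz => hi ?_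
    rcases (Finset.mem_filter.1 hz).2 with rfl | hz
    · exact hmv
    · refine lt_of_not_ge fun hvz => ?_
      rcases hvz.eq_or_lt with rfl | hvz
      · exact h2 hz
      · exact havoid u m v z hum hmv hvz huv hz h1 h2
  -- The vertices reachable from `u` by increasing steps along non-edges between live vertices.
  let U : ℕ → V → V → Prop := fun T u w =>
    ∃ m, T ≤ r m ∧ u ≤ m ∧ m ≤ w ∧ ¬G.Adj u m ∧ ¬G.Adj m w
  have U_up {T : ℕ} {u a b : V} (ha : T ≤ r a) (hab : a < b) (h : ¬G.Adj a b) (hU : U T u a) :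
      U T u b := by
    obtain ⟨m, hm, hum, hma, h1, h2⟩ := hU
    by_cases hmb : G.Adj m b
    · by_cases hua : G.Adj u a
      · exfalso
        have hma' : m ≠ a := fun e => h (e ▸ hmb)
        have hum' : u ≠ m := fun e => h2 (e ▸ hua)
        exact havoid u m a b (lt_of_le_of_ne hum hum') (lt_of_le_of_ne hma hma') hab hua hmb h1 h2
      · exact ⟨a, ha, hum.trans hma, hab.le, hua, h⟩
    · exact ⟨m, hm, hum, hma.trans hab.le, h1, hmb⟩
  let y : ℕ → V × V → V → ℕ := fun T q w => i w + if U T q.1 w then i q.2 - i q.1 else 0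
  have y_le (T : ℕ) (q : V × V) (w : V) : y T q w ≤ 2 * N := by
    have h1 := hN w
    have h2 := hN q.2
    simp only [y]
    split_ifs <;> omega
  have y_lt {T : ℕ} (q : V × V) {a b : V} (ha : T ≤ r a) (hab : a < b) (h : ¬G.Adj a b) :
      y T q a < y T q b := by
    have h1 := hi hab
    have h2 := U_up (u := q.1) ha hab h
    simp only [y]
    split_ifs <;> first | omega | exact absurd (h2 ‹_›) ‹_›
  have y_eq {u v : V} (huv : u < v) (h : G.Adj u v) :
      y (min (r u) (r v)) (u, v) u = y (min (r u) (r v)) (u, v) v := by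
    have hu : U (min (r u) (r v)) u u := ⟨u, min_le_left _ _, le_rfl, le_rfl, by simp, by simp⟩
    have hv : ¬U (min (r u) (r v)) u v := by
      rintro ⟨m, hm, hum, hmv, h1, h2⟩
      have hum' : u ≠ m := fun e => h2 (e ▸ h)
      have hmv' : m ≠ v := fun e => h1 (e ▸ h)
      have hlt := r_lt (lt_of_le_of_ne hum hum') (lt_of_le_of_ne hmv hmv') h h1 h2
      have h3 := r_adj h
      have h4 := r_self v
      omega
    have h1 := hi huv
    simp only [y, if_pos hu, if_neg hv]
    omega
  let x : ℕ → V → ℕ := fun h w =>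
    2 * N * h + Nat.casesOn h (i w) fun k => y (k / K) (p (k % K)) w
  refine ⟨x, fun w => K * (r w + 1), fun w => monotone_nat_of_le_succ fun h => ?_,
    fun u v huv => ?_, fun h u v hu hv huv hadj => ?_, fun u v huv hadj => ?_⟩
  · have hxh : x h w ≤ 2 * N * h + 2 * N := by
      refine Nat.add_le_add_left ?_ _
      cases h with
      | zero => exact (hN w).trans (by omega)
      | succ k => exact y_le _ _ _
    calc x h w ≤ 2 * N * (h + 1) := by rw [mul_add, mul_one]; exact hxh
      _ ≤ x (h + 1) w := Nat.le_add_right _ _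
  · simpa [x] using hi huv
  · cases h with
    | zero => simpa [x] using hi huv
    | succ k =>
      refine Nat.add_lt_add_left (y_lt _ ?_ huv hadj) _
      refine Nat.lt_succ_iff.1 ((Nat.div_lt_iff_lt_mul hK).2 ?_)
      rw [mul_comm]
      exact hu
  · obtain ⟨c, hc, hpc⟩ := hp (u, v)
    have hle {w : V} (hw : min (r u) (r v) ≤ r w) :
        K * min (r u) (r v) + c + 1 ≤ K * (r w + 1) := by
      have := Nat.mul_le_mul_left K hw
      rw [mul_add, mul_one]
      omega
    refine ⟨_, hle (min_le_left _ _), hle (min_le_right _ _), ?_⟩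
    have hdiv : (K * min (r u) (r v) + c) / K = min (r u) (r v) := by
      rw [Nat.mul_add_div hK, Nat.div_eq_of_lt hc, add_zero]
    have hmod : (K * min (r u) (r v) + c) % K = c := by
      rw [Nat.mul_add_mod, Nat.mod_eq_of_lt hc]
    simp only [x, hdiv, hmod, hpc, y_eq huv hadj]


/-- A finite graph with a vertex order avoiding the pattern `P_{ab}` admits a
grounded stairs representation. -/
theorem avoids_Pab_has_grounded_stairs_representation
    {V : Type*} [Fintype V] [LinearOrder V] (G : SimpleGraph V)
    (havoid : ∀ v1 v2 v3 v4 : V, v1 < v2 → v2 < v3 → v3 < v4 →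
      G.Adj v1 v3 → G.Adj v2 v4 → ¬G.Adj v1 v2 → ¬G.Adj v2 v3 → False) :
    ∃ (g : V → ℝ) (γ : V → ℝ → ℝ × ℝ),
      Function.Injective g ∧
      StrictMono g ∧
      (∀ v, ContinuousOn (γ v) (Set.Icc 0 1)) ∧
      (∀ v, MonotoneOn (fun t => (γ v t).1) (Set.Icc 0 1)) ∧
      (∀ v, MonotoneOn (fun t => (γ v t).2) (Set.Icc 0 1)) ∧
      (∀ v, ∀ t ∈ Set.Icc (0 : ℝ) 1, 0 ≤ (γ v t).2) ∧
      (∀ v, γ v 0 = (g v, 0)) ∧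
      (∀ u v, u ≠ v →
        ∀ p ∈ γ u '' Set.Icc (0 : ℝ) 1 ∩ γ v '' Set.Icc (0 : ℝ) 1, p.2 ≠ 0) ∧
      (∀ u v, u ≠ v →
        (G.Adj u v ↔ (γ u '' Set.Icc (0 : ℝ) 1 ∩ γ v '' Set.Icc (0 : ℝ) 1).Nonempty)) := by
  obtain ⟨x, L, hmono, hx0, hlt, heq⟩ := exists_sweep_of_avoids G havoid
  obtain ⟨M, hM⟩ : ∃ M, ∀ v, L v < M :=
    ⟨Finset.univ.sup L + 1, fun v => Nat.lt_succ_of_le (Finset.le_sup (Finset.mem_univ v))⟩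
  let P : V → ℝ → ℝ := fun v => interp M fun h => x h v
  let height : V → ℝ → ℝ := fun v t => min (t * M) (L v)
  have hP0 (v : V) : P v 0 = x 0 v := by
    simpa using interp_natCast ((Nat.zero_le _).trans_lt (hM v)) fun h => (x h v : ℝ)
  have hPmono (v : V) : Monotone (P v) :=
    interp_monotone M fun _ _ h => Nat.cast_le.2 (hmono v h)
  have hheight (v : V) : Monotone (height v) := fun s t hst => by
    simp only [height]
    gcongr
  have hnonneg (v : V) {t : ℝ} (ht : t ∈ Set.Icc (0 : ℝ) 1) : 0 ≤ height v t :=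
    le_min (mul_nonneg ht.1 (Nat.cast_nonneg _)) (Nat.cast_nonneg _)
  have hPlt {u v : V} (huv : u < v) (hadj : ¬G.Adj u v) {s : ℝ} (hs : 0 ≤ s) (hsu : s ≤ L u)
      (hsv : s ≤ L v) : P u s < P v s := by
    refine interp_lt_interp (L := min (L u) (L v)) ((min_le_left _ _).trans_lt (hM u))
      (fun h hh => Nat.cast_lt.2 ?_) hs (by rw [Nat.cast_min]; exact le_min hsu hsv)
    exact hlt h u v (hh.trans (min_le_left _ _)) (hh.trans (min_le_right _ _)) huv hadj
  have hg : StrictMono fun v => (x 0 v : ℝ) := fun _ _ h => Nat.cast_lt.2 (hx0 h)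
  have hmeet {u v : V} (huv : u < v) (hadj : G.Adj u v) :
      ((fun t => (P u (height u t), height u t)) '' Set.Icc (0 : ℝ) 1 ∩
        (fun t => (P v (height v t), height v t)) '' Set.Icc (0 : ℝ) 1).Nonempty := by
    obtain ⟨h, hu, hv, hxeq⟩ := heq u v huv hadj
    have hhM : h < M := hu.trans_lt (hM u)
    have hMpos : (0 : ℝ) < M := by exact_mod_cast (Nat.zero_le h).trans_lt hhM
    have hmem {w : V} (hw : h ≤ L w) : ((x h w : ℝ), (h : ℝ)) ∈
        (fun t => (P w (height w t), height w t)) '' Set.Icc (0 : ℝ) 1 := by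
      refine ⟨h / M, ⟨by positivity, (div_le_one hMpos).2 (Nat.cast_le.2 hhM.le)⟩, ?_⟩
      have hhw : height w (h / M) = h := by
        simp only [height]
        rw [div_mul_cancel₀ _ hMpos.ne', min_eq_left (Nat.cast_le.2 hw)]
      simp only [hhw]
      exact congrArg (·, (h : ℝ)) (interp_natCast hhM _)
    exact ⟨_, hmem hu, hxeq ▸ hmem hv⟩
  refine ⟨fun v => x 0 v, fun v t => (P v (height v t), height v t), hg.injective, hg,
    fun v => Continuous.continuousOn ?_, fun v => ((hPmono v).comp (hheight v)).monotoneOn _,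
    fun v => (hheight v).monotoneOn _, fun v t ht => hnonneg v ht, fun v => ?_, ?_,
    fun u v huv => ⟨fun hadj => ?_, ?_⟩⟩
  · have hheight_cont : Continuous (height v) := by
      simp only [height]
      fun_prop
    exact ((interp_continuous M _).comp hheight_cont).prodMk hheight_cont
  · have h0 : height v 0 = 0 := by simp [height]
    simp only [h0, hP0]
  · rintro u v huv _ ⟨⟨s, -, rfl⟩, t, -, ht⟩ h0
    simp only [Prod.mk.injEq] at ht h0
    rw [ht.2, h0, hP0, hP0] at ht
    exact huv (hg.injective ht.1).symm
  · rcases huv.lt_or_gt with h | h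
    · exact hmeet h hadj
    · rw [Set.inter_comm]
      exact hmeet h hadj.symm
  · rintro ⟨_, ⟨s, hs, rfl⟩, t, -, ht⟩
    simp only [Prod.mk.injEq] at ht
    by_contra hadj
    have hs0 := hnonneg u hs
    have hsu : height u s ≤ L u := min_le_right _ _
    have hsv : height u s ≤ L v := ht.2 ▸ min_le_right _ _
    have hPeq := ht.1
    rw [ht.2] at hPeq
    rcases huv.lt_or_gt with h | h
    · exact (hPlt h hadj hs0 hsu hsv).ne hPeq.symm
    · exact (hPlt h (fun h' => hadj h'.symm) hs0 hsv hsu).ne hPeq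
end

section
/- Let G be a finite simple graph with vertex set V equipped with a grounded stairs representation: an injective function g : V → ℝ and, for each vertex v, a continuous curve γ_v : [0,1] → ℝ × [0, ∞) whose two coordinate functions are both monotone nondecreasing, with γ_v(0) = (g(v), 0), such that no point of the x-axis belongs to the images of two distinct curves, and two distinct vertices u, v are adjacent in G if and only if the images of γ_u and γ_v intersect. Then the linear order of V given by g avoids the pattern P_{abc}: there are no vertices v1, v2, v3, v4 with g(v1) < g(v2) < g(v3) < g(v4) such that v1v3 and v2v4 are edges of G while v1v2, v2v3 and v3v4 are non-edges of G. -/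
/-- A continuous curve with both coordinates monotone is a graph over the sum of the coordinates. -/
theorem exists_graph_of_monotone_curve {γ : ℝ → ℝ × ℝ}
    (hcont : ContinuousOn γ (Set.Icc 0 1))
    (hmono1 : MonotoneOn (fun t => (γ t).1) (Set.Icc 0 1))
    (hmono2 : MonotoneOn (fun t => (γ t).2) (Set.Icc 0 1)) :
    ∃ f : ℝ → ℝ,
      ContinuousOn f (Set.Icc ((γ 0).1 + (γ 0).2) ((γ 1).1 + (γ 1).2)) ∧
      γ '' Set.Icc 0 1 = (fun s => (f s, s - f s)) ''
        Set.Icc ((γ 0).1 + (γ 0).2) ((γ 1).1 + (γ 1).2) := by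
  have hsum : ContinuousOn (fun t => (γ t).1 + (γ t).2) (Set.Icc 0 1) :=
    hcont.fst.add hcont.snd
  have hivt : ∀ s ∈ Set.Icc ((γ 0).1 + (γ 0).2) ((γ 1).1 + (γ 1).2),
      ∃ t ∈ Set.Icc (0 : ℝ) 1, (γ t).1 + (γ t).2 = s :=
    fun _ hs => intermediate_value_Icc zero_le_one hsum hs
  have key : ∀ t ∈ Set.Icc (0 : ℝ) 1, ∀ t' ∈ Set.Icc (0 : ℝ) 1,
      (γ t).1 + (γ t).2 ≤ (γ t').1 + (γ t').2 →
        (γ t).1 ≤ (γ t').1 ∧ (γ t).2 ≤ (γ t').2 := by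
    intro t ht t' ht' h
    rcases le_total t t' with htt | htt
    · exact ⟨hmono1 ht ht' htt, hmono2 ht ht' htt⟩
    · have h1 := hmono1 ht' ht htt
      have h2 := hmono2 ht' ht htt
      dsimp only at h1 h2
      constructor <;> linarith
  choose! τ hτ hτs using hivt
  refine ⟨fun s => (γ (τ s)).1, ?_, ?_⟩
  · refine LipschitzOnWith.continuousOn (K := 1) (LipschitzOnWith.of_le_add fun s hs s' hs' => ?_)
    rw [Real.dist_eq]
    have e := hτs _ hs
    have e' := hτs _ hs'
    rcases le_total s s' with h | h
    · have := (key _ (hτ _ hs) _ (hτ _ hs') (by linarith)).1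
      linarith [abs_nonneg (s - s')]
    · have := (key _ (hτ _ hs') _ (hτ _ hs) (by linarith)).2
      linarith [le_abs_self (s - s')]
  · ext p
    constructor
    · rintro ⟨t, ht, rfl⟩
      have hs : (γ t).1 + (γ t).2 ∈
          Set.Icc ((γ 0).1 + (γ 0).2) ((γ 1).1 + (γ 1).2) := by
        have a0 := hmono1 (by simp) ht ht.1
        have b0 := hmono2 (by simp) ht ht.1
        have a1 := hmono1 ht (by simp) ht.2
        have b1 := hmono2 ht (by simp) ht.2
        exact ⟨add_le_add a0 b0, add_le_add a1 b1⟩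
      have e := hτs _ hs
      have hle := key _ (hτ _ hs) _ ht e.le
      have hge := key _ ht _ (hτ _ hs) e.ge
      refine ⟨_, hs, Prod.ext (le_antisymm hle.1 hge.1) ?_⟩
      dsimp only
      linarith [hle.1, hge.1]
    · rintro ⟨s, hs, rfl⟩
      refine ⟨τ s, hτ _ hs, Prod.ext rfl ?_⟩
      dsimp only
      linarith [hτs _ hs]

/-- Two continuous functions that never agree, the first below the diagonal and the second starting
on the diagonal later than the first, are strictly ordered on their common domain. -/
theorem lt_of_forall_ne_of_le_diagonal {f h : ℝ → ℝ} {a A b B : ℝ} (hab : a ≤ b)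
    (hf : ContinuousOn f (Set.Icc a A)) (hh : ContinuousOn h (Set.Icc b B))
    (hfle : ∀ s ∈ Set.Icc a A, f s ≤ s) (hb : h b = b)
    (hne : ∀ s ∈ Set.Icc a A, s ∈ Set.Icc b B → f s ≠ h s)
    {s : ℝ} (hbs : b ≤ s) (hsA : s ≤ A) (hsB : s ≤ B) : f s < h s := by
  by_contra! hlt
  have hcont : ContinuousOn (fun r => f r - h r) (Set.Icc b s) :=
    (hf.mono (Set.Icc_subset_Icc hab hsA)).sub (hh.mono (Set.Icc_subset_Icc_right hsB))
  have hfb : f b ≤ b := hfle b ⟨hab, hbs.trans hsA⟩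
  obtain ⟨r, hr, hr0⟩ := intermediate_value_Icc hbs hcont
    (show (0 : ℝ) ∈ Set.Icc (f b - h b) (f s - h s) from ⟨by linarith, by linarith⟩)
  exact hne r ⟨hab.trans hr.1, hr.2.trans hsA⟩ ⟨hr.1, hr.2.trans hsB⟩ (sub_eq_zero.mp hr0)


/-- In a grounded stairs representation of a finite graph, the grounding order
avoids the pattern `P_{abc}`. -/
theorem grounded_stairs_order_avoids_Pabc
    {V : Type*} [Fintype V] (G : SimpleGraph V)
    (g : V → ℝ) (γ : V → ℝ → ℝ × ℝ)
    (hg : Function.Injective g)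
    (hcont : ∀ v, ContinuousOn (γ v) (Set.Icc 0 1))
    (hmono1 : ∀ v, MonotoneOn (fun t => (γ v t).1) (Set.Icc 0 1))
    (hmono2 : ∀ v, MonotoneOn (fun t => (γ v t).2) (Set.Icc 0 1))
    (hupper : ∀ v, ∀ t ∈ Set.Icc (0 : ℝ) 1, 0 ≤ (γ v t).2)
    (h0 : ∀ v, γ v 0 = (g v, 0))
    (haxis : ∀ u v, u ≠ v →
      ∀ p ∈ γ u '' Set.Icc (0 : ℝ) 1 ∩ γ v '' Set.Icc (0 : ℝ) 1, p.2 ≠ 0)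
    (hadj : ∀ u v, u ≠ v →
      (G.Adj u v ↔ (γ u '' Set.Icc (0 : ℝ) 1 ∩ γ v '' Set.Icc (0 : ℝ) 1).Nonempty)) :
    ∀ v1 v2 v3 v4 : V, g v1 < g v2 → g v2 < g v3 → g v3 < g v4 →
      G.Adj v1 v3 → G.Adj v2 v4 →
      ¬G.Adj v1 v2 → ¬G.Adj v2 v3 → ¬G.Adj v3 v4 → False := by
  intro v1 v2 v3 v4 h12 h23 h34 a13 a24 n12 n23 n34
  choose f hf himg using fun v =>
    exists_graph_of_monotone_curve (hcont v) (hmono1 v) (hmono2 v)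
  simp only [h0, add_zero] at hf himg
  set S : V → ℝ := fun v => (γ v 1).1 + (γ v 1).2 with hS
  have hle : ∀ v, ∀ s ∈ Set.Icc (g v) (S v), f v s ≤ s := by
    intro v s hs
    obtain ⟨t, ht, e⟩ := (himg v).symm.subset ⟨s, hs, rfl⟩
    have hy := hupper v t ht
    rw [e] at hy
    exact sub_nonneg.mp hy
  have hstart : ∀ v, f v (g v) = g v := by
    intro v
    obtain ⟨s, hs, e⟩ := (himg v).subset ⟨0, by simp, h0 v⟩
    have e1 : f v s = g v := congrArg Prod.fst e
    have e2 : s - f v s = 0 := congrArg Prod.snd e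
    have es : s = g v := by linarith
    rwa [es] at e1
  have hmeet : ∀ u v, G.Adj u v →
      ∃ s ∈ Set.Icc (g u) (S u), s ∈ Set.Icc (g v) (S v) ∧ f u s = f v s := by
    intro u v huv
    obtain ⟨p, hpu, hpv⟩ := (hadj u v huv.ne).mp huv
    obtain ⟨s, hs, e⟩ := (himg u).subset hpu
    obtain ⟨s', hs', e'⟩ := (himg v).subset hpv
    have e1 : f u s = f v s' := congrArg Prod.fst (e.trans e'.symm)
    have e2 : s - f u s = s' - f v s' := congrArg Prod.snd (e.trans e'.symm)
    obtain rfl : s = s' := by linarith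
    exact ⟨s, hs, hs', e1⟩
  have hlt : ∀ u v, g u < g v → ¬G.Adj u v →
      ∀ s, g v ≤ s → s ≤ S u → s ≤ S v → f u s < f v s := by
    intro u v huv hn s hs hsu hsv
    refine lt_of_forall_ne_of_le_diagonal huv.le (hf u) (hf v) (hle u) (hstart v)
      (fun r hru hrv e => hn ?_) hs hsu hsv
    refine (hadj u v (ne_of_apply_ne g huv.ne)).mpr ⟨(f u r, r - f u r), ?_, ?_⟩
    · exact (himg u).symm.subset ⟨r, hru, rfl⟩
    · exact (himg v).symm.subset ⟨r, hrv, by simp only [e]⟩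
  obtain ⟨p, hp1, hp3, ep⟩ := hmeet v1 v3 a13
  obtain ⟨q, hq2, hq4, eq⟩ := hmeet v2 v4 a24
  rcases le_total p q with hpq | hqp
  · have hp2 : p ≤ S v2 := hpq.trans hq2.2
    have l12 := hlt v1 v2 h12 n12 p (h23.le.trans hp3.1) hp1.2 hp2
    have l23 := hlt v2 v3 h23 n23 p hp3.1 hp2 hp3.2
    exact (l12.trans l23).ne ep
  · have hq3 : q ≤ S v3 := hqp.trans hp3.2
    have l23 := hlt v2 v3 h23 n23 q (h34.le.trans hq4.1) hq2.2 hq3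
    have l34 := hlt v3 v4 h34 n34 q hq4.1 hq3 hq4.2
    exact (l23.trans l34).ne eq
end

section
/- Let G be a finite simple graph with vertex set V equipped with a grounded convex representation: for each vertex v a nonempty compact convex set S_v ⊆ ℝ × [0, ∞) together with a grounding point (g(v), 0) ∈ S_v, where g : V → ℝ is injective, no point of the x-axis belongs to two of the sets, no point of the plane belongs to three of the sets, and two distinct vertices u, v are adjacent in G if and only if S_u ∩ S_v ≠ ∅. Then the linear order of V given by g avoids the pattern P_{abc}: there are no vertices v1, v2, v3, v4 with g(v1) < g(v2) < g(v3) < g(v4) such that v1v3 and v2v4 are edges of G while v1v2, v2v3 and v3v4 are non-edges of G. -/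
/-- The affine function vanishing on the line through `(a, 0)` and `P`. If `0 < P.2`, it is
positive at the points of the `x`-axis to the right of `(a, 0)`. -/
def lineForm (a : ℝ) (P z : ℝ × ℝ) : ℝ := P.2 * (z.1 - a) - z.2 * (P.1 - a)

theorem continuous_lineForm (a : ℝ) (P : ℝ × ℝ) : Continuous (lineForm a P) := by
  unfold lineForm
  fun_prop

theorem lineForm_sub_lineForm (a c : ℝ) (P z : ℝ × ℝ) :
    lineForm a P z - lineForm c P z = (c - a) * (P.2 - z.2) := by
  unfold lineForm
  ring

theorem convex_setOf_lineForm_nonneg (a : ℝ) (P : ℝ × ℝ) :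
    Convex ℝ {z | 0 ≤ lineForm a P z} := by
  intro x hx y hy s t hs ht hst
  have key : lineForm a P (s • x + t • y) = s * lineForm a P x + t * lineForm a P y := by
    obtain rfl : t = 1 - s := by linarith
    simp only [lineForm, Prod.fst_add, Prod.snd_add, Prod.smul_fst, Prod.smul_snd, smul_eq_mul]
    ring
  simp only [Set.mem_ofPred_eq] at hx hy ⊢
  rw [key]
  positivity

/-- A point of the line through `(a, 0)` and `P` whose height is between `0` and that of `P` lies
in every convex set containing `(a, 0)` and `P`. -/
theorem Convex.mem_of_lineForm_eq_zero {T : Set (ℝ × ℝ)} (hT : Convex ℝ T) {a : ℝ}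
    {P z : ℝ × ℝ} (ha : (a, (0 : ℝ)) ∈ T) (hP : P ∈ T) (hpos : 0 < P.2) (hz : 0 ≤ z.2)
    (hzP : z.2 ≤ P.2) (h : lineForm a P z = 0) : z ∈ T := by
  have hmem := hT ha hP (sub_nonneg.2 ((div_le_one hpos).2 hzP)) (div_nonneg hz hpos.le)
    (sub_add_cancel 1 (z.2 / P.2))
  convert hmem using 1
  unfold lineForm at h
  ext
  · simp only [Prod.fst_add, Prod.smul_fst, smul_eq_mul]
    field_simp
    linarith
  · simp only [Prod.snd_add, Prod.smul_snd, smul_eq_mul]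
    field_simp
    ring

theorem Convex.exists_eq_zero {T : Set (ℝ × ℝ)} (hT : Convex ℝ T) {f : ℝ × ℝ → ℝ}
    (hf : Continuous f) {x y : ℝ × ℝ} (hx : x ∈ T) (hy : y ∈ T) (hfx : f x ≤ 0)
    (hfy : 0 ≤ f y) : ∃ z ∈ T, f z = 0 :=
  hT.isPreconnected.intermediate_value hx hy hf.continuousOn ⟨hfx, hfy⟩

/-- In a grounded convex representation of a finite graph, the grounding order
avoids the pattern `P_{abc}`. -/
theorem grounded_convex_order_avoids_Pabc
    {V : Type*} [Fintype V] (G : SimpleGraph V)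
    (S : V → Set (ℝ × ℝ)) (g : V → ℝ)
    (hne : ∀ v, (S v).Nonempty)
    (hcompact : ∀ v, IsCompact (S v))
    (hconvex : ∀ v, Convex ℝ (S v))
    (hupper : ∀ v, ∀ p ∈ S v, 0 ≤ p.2)
    (hground : ∀ v, ((g v : ℝ), (0 : ℝ)) ∈ S v)
    (hg : Function.Injective g)
    (haxis : ∀ u v, u ≠ v → ∀ p : ℝ × ℝ, p ∈ S u → p ∈ S v → p.2 ≠ 0)
    (hthree : ∀ u v w, u ≠ v → u ≠ w → v ≠ w →
      ∀ p : ℝ × ℝ, ¬(p ∈ S u ∧ p ∈ S v ∧ p ∈ S w))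
    (hadj : ∀ u v, u ≠ v → (G.Adj u v ↔ (S u ∩ S v).Nonempty)) :
    ∀ v1 v2 v3 v4 : V, g v1 < g v2 → g v2 < g v3 → g v3 < g v4 →
      G.Adj v1 v3 → G.Adj v2 v4 →
      ¬G.Adj v1 v2 → ¬G.Adj v2 v3 → ¬G.Adj v3 v4 → False := by
  intro v1 v2 v3 v4 h12 h23 h34 h13 h24 n12 n23 n34
  have disjoint {u v : V} (huv : g u < g v) (h : ¬G.Adj u v) {z : ℝ × ℝ} (hu : z ∈ S u)
      (hv : z ∈ S v) : False :=
    h ((hadj u v (ne_of_apply_ne g huv.ne)).2 ⟨z, hu, hv⟩)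
  obtain ⟨P, hP1, hP3⟩ := (hadj _ _ h13.ne).1 h13
  obtain ⟨Q, hQ2, hQ4⟩ := (hadj _ _ h24.ne).1 h24
  have hP : 0 < P.2 := (hupper _ _ hP1).lt_of_ne' (haxis _ _ h13.ne _ hP1 hP3)
  have height_le {z : ℝ × ℝ} (h1 : 0 ≤ lineForm (g v1) P z) (h3 : lineForm (g v3) P z ≤ 0) :
      z.2 ≤ P.2 := by
    have := lineForm_sub_lineForm (g v1) (g v3) P z
    nlinarith
  have lineForm_axis (a x : ℝ) : lineForm a P (x, 0) = P.2 * (x - a) := by simp [lineForm]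
  by_cases hQ : 0 ≤ lineForm (g v1) P Q ∧ lineForm (g v3) P Q ≤ 0
  · have hD : 0 ≤ lineForm (g v1) P (g v4, 0) := by
      rw [lineForm_axis]
      exact mul_nonneg hP.le (by linarith)
    have hD' : 0 ≤ lineForm (g v3) P (g v4, 0) := by
      rw [lineForm_axis]
      exact mul_nonneg hP.le (by linarith)
    obtain ⟨z, ⟨hz4, hz1⟩, hz⟩ :=
      ((hconvex v4).inter (convex_setOf_lineForm_nonneg (g v1) P)).exists_eq_zero
        (continuous_lineForm (g v3) P) ⟨hQ4, hQ.1⟩ ⟨hground v4, hD⟩ hQ.2 hD'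
    exact disjoint h34 n34 ((hconvex v3).mem_of_lineForm_eq_zero (hground v3) hP3 hP
      (hupper _ _ hz4) (height_le hz1 hz.le) hz) hz4
  · have hQ' : min (lineForm (g v1) P Q) (-lineForm (g v3) P Q) ≤ 0 := by
      by_contra! h
      rw [lt_min_iff] at h
      exact hQ ⟨h.1.le, by linarith⟩
    have hB : 0 ≤ min (lineForm (g v1) P (g v2, 0)) (-lineForm (g v3) P (g v2, 0)) := by
      rw [lineForm_axis, lineForm_axis]
      exact le_min (by nlinarith) (by nlinarith)
    obtain ⟨z, hz2, hz⟩ := (hconvex v2).exists_eq_zero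
      ((continuous_lineForm (g v1) P).min (continuous_lineForm (g v3) P).neg)
      hQ2 (hground v2) hQ' hB
    have hz1 : 0 ≤ lineForm (g v1) P z := hz.ge.trans (min_le_left _ _)
    have hz3 : lineForm (g v3) P z ≤ 0 := neg_nonneg.1 (hz.ge.trans (min_le_right _ _))
    rcases min_choice (lineForm (g v1) P z) (-lineForm (g v3) P z) with h | h
    · exact disjoint h12 n12 ((hconvex v1).mem_of_lineForm_eq_zero (hground v1) hP1 hP
        (hupper _ _ hz2) (height_le hz1 hz3) (h.symm.trans hz)) hz2
    · exact disjoint h23 n23 hz2 ((hconvex v3).mem_of_lineForm_eq_zero (hground v3) hP3 hP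
        (hupper _ _ hz2) (height_le hz1 hz3) (neg_eq_zero.1 (h.symm.trans hz)))
end

section
/- Let G1 be the graph on vertex set {0, 1, ..., 7} whose edge set consists of the edges {i, i+1} for 0 ≤ i ≤ 6, together with {0,7}, {0,4} and {2,6}. Then G1 admits a linear order of its vertices avoiding the pattern P_{ab} (for instance the order 0, 1, 3, 4, 5, 6, 2, 7), but G1 admits no linear order of its vertices avoiding the pattern P_a. Consequently, the class C_a is strictly contained in the class C_{ab}. -/
/-- The order given by an injective `f : V → ℝ` avoids the pattern `P_a`
(edges 13 and 24, non-edge 12). -/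
def AvoidsPa {V : Type*} (G : SimpleGraph V) (f : V → ℝ) : Prop :=
  ∀ v1 v2 v3 v4 : V, f v1 < f v2 → f v2 < f v3 → f v3 < f v4 →
    G.Adj v1 v3 → G.Adj v2 v4 → ¬G.Adj v1 v2 → False

/-- The order given by an injective `f : V → ℝ` avoids the pattern `P_{ab}`
(edges 13 and 24, non-edges 12 and 23). -/
def AvoidsPab {V : Type*} (G : SimpleGraph V) (f : V → ℝ) : Prop :=
  ∀ v1 v2 v3 v4 : V, f v1 < f v2 → f v2 < f v3 → f v3 < f v4 →
    G.Adj v1 v3 → G.Adj v2 v4 → ¬G.Adj v1 v2 → ¬G.Adj v2 v3 → False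

/-- The class `C_a`: graphs admitting a vertex order avoiding `P_a`. -/
def InCa {V : Type*} (G : SimpleGraph V) : Prop :=
  ∃ f : V → ℝ, Function.Injective f ∧ AvoidsPa G f

/-- The class `C_{ab}`: graphs admitting a vertex order avoiding `P_{ab}`. -/
def InCab {V : Type*} (G : SimpleGraph V) : Prop :=
  ∃ f : V → ℝ, Function.Injective f ∧ AvoidsPab G f

/-- The graph `G1` on vertices `0, …, 7` with edges `{i, i+1}` for `0 ≤ i ≤ 6`
together with `{0,7}`, `{0,4}` and `{2,6}`. -/
def G1 : SimpleGraph (Fin 8) :=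
  SimpleGraph.fromRel (fun i j =>
    (i.val + 1 = j.val) ∨ (i = 0 ∧ j = 7) ∨ (i = 0 ∧ j = 4) ∨ (i = 2 ∧ j = 6))

instance : DecidableRel G1.Adj := fun i j =>
  decidable_of_iff _ (SimpleGraph.fromRel_adj _ i j).symm

section InitialSegment

variable {V : Type*}

/-- The list `L` enumerates, in decreasing order, an initial segment of the order given by `f`,
and the list `R` enumerates the remaining vertices. -/
structure IsInitialSegment (f : V → ℝ) (L R : List V) : Prop where
  pairwise : L.Pairwise (fun a b => f b < f a)
  lt : ∀ x ∈ L, ∀ y ∈ R, f x < f y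
  nodup : R.Nodup

theorem IsInitialSegment.exists_cons [DecidableEq V] {f : V → ℝ} (hf : Function.Injective f)
    {L R : List V} (h : IsInitialSegment f L R) (hR : R ≠ []) :
    ∃ c ∈ R, IsInitialSegment f (c :: L) (R.erase c) := by
  obtain ⟨c, hc, hmin⟩ := Set.exists_min_image {c | c ∈ R} f R.finite_toSet
    (List.exists_mem_of_ne_nil R hR)
  refine ⟨c, hc, List.pairwise_cons.2 ⟨fun x hx => h.lt x hx c hc, h.pairwise⟩,
    fun x hx y hy => ?_, h.nodup.erase c⟩
  obtain ⟨hyc, hyR⟩ := h.nodup.mem_erase_iff.1 hy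
  rcases List.mem_cons.1 hx with rfl | hx
  · exact (hmin y hyR).lt_of_ne fun heq => hyc (hf heq).symm
  · exact h.lt x hx y hyR

variable (G : SimpleGraph V) [DecidableRel G.Adj]

/-- Placing `c` right after the initial segment `L`, with remaining vertices `R`, forces an
occurrence of `P_a` in which `c` is the third vertex. -/
def forcesPa (c : V) (R : List V) : List V → Bool
  | [] => false
  | v2 :: L =>
    (R.any (fun v4 => G.Adj v2 v4) && L.any (fun v1 => G.Adj v1 c && !decide (G.Adj v1 v2)))
      || forcesPa c R L

/-- A search of depth at most `n` shows that no order avoiding `P_a` starts with the initial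
segment `L`, where `R` lists the remaining vertices. -/
def noExtension [DecidableEq V] : ℕ → List V → List V → Bool
  | 0, _, _ => false
  | n + 1, L, R => !R.isEmpty &&
    R.all fun c => forcesPa G c (R.erase c) L || noExtension n (c :: L) (R.erase c)

variable {G}

theorem not_avoidsPa_of_forcesPa {f : V → ℝ} {c : V} {L R : List V}
    (h : IsInitialSegment f (c :: L) R) (hc : forcesPa G c R L = true) : ¬AvoidsPa G f := by
  induction L with
  | nil => simp [forcesPa] at hc
  | cons v2 L ih =>
    have hsub : (c :: L).Sublist (c :: v2 :: L) := (List.sublist_cons_self v2 L).cons_cons c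
    simp only [forcesPa, Bool.or_eq_true, Bool.and_eq_true, List.any_eq_true, decide_eq_true_eq,
      Bool.not_eq_true', decide_eq_false_iff_not] at hc
    rcases hc with ⟨⟨v4, h4, h24⟩, v1, h1, h13, h12⟩ | hc
    · have hp := List.pairwise_cons.1 h.pairwise
      exact fun ha => ha v1 v2 c v4 ((List.pairwise_cons.1 hp.2).1 v1 h1) (hp.1 v2 (by simp))
        (h.lt c (by simp) v4 h4) h13 h24 h12
    · exact ih ⟨h.pairwise.sublist hsub, fun x hx => h.lt x (hsub.subset hx), h.nodup⟩ hc

theorem not_avoidsPa_of_noExtension [DecidableEq V] {f : V → ℝ} (hf : Function.Injective f)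
    {n : ℕ} {L R : List V} (h : noExtension G n L R = true) (hL : IsInitialSegment f L R) :
    ¬AvoidsPa G f := by
  induction n generalizing L R with
  | zero => simp [noExtension] at h
  | succ n ih =>
    simp only [noExtension, Bool.and_eq_true, Bool.not_eq_true', List.isEmpty_eq_false_iff,
      List.all_eq_true, Bool.or_eq_true] at h
    obtain ⟨c, hc, hcL⟩ := hL.exists_cons hf h.1
    rcases h.2 c hc with hforce | hext
    · exact not_avoidsPa_of_forcesPa hcL hforce
    · exact ih hext hcL

end InitialSegment

theorem InCa.inCab {V : Type*} {G : SimpleGraph V} (h : InCa G) : InCab G := by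
  obtain ⟨f, hf, ha⟩ := h
  exact ⟨f, hf, fun v1 v2 v3 v4 h1 h2 h3 h13 h24 h12 _ => ha v1 v2 v3 v4 h1 h2 h3 h13 h24 h12⟩

/-- The position of each vertex of `G1` in the order `0, 1, 3, 4, 5, 6, 2, 7`. -/
def G1Position : Fin 8 → ℕ := ![0, 1, 6, 2, 3, 4, 5, 7]

theorem inCab_G1 : InCab G1 := by
  refine ⟨fun v => (G1Position v : ℝ), Nat.cast_injective.comp (by decide), ?_⟩
  simp only [AvoidsPab, Nat.cast_lt]
  decide +kernel

theorem not_inCa_G1 : ¬InCa G1 := by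
  rintro ⟨f, hf, ha⟩
  have h : noExtension G1 7 [] (List.finRange 8) = true := by decide +kernel
  exact not_avoidsPa_of_noExtension hf h ⟨List.Pairwise.nil, by simp, List.nodup_finRange 8⟩ ha

/-- `G1` is in `C_{ab}` but not in `C_a`; consequently `C_a ⊊ C_{ab}`. -/
theorem G1_in_Cab_not_in_Ca :
    InCab G1 ∧
    ¬InCa G1 ∧
    (∀ (V : Type) (_ : Finite V) (G : SimpleGraph V), InCa G → InCab G) ∧
    (∃ (V : Type) (_ : Finite V) (G : SimpleGraph V), InCab G ∧ ¬InCa G) := by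
  exact ⟨inCab_G1, not_inCa_G1, fun _ _ _ h => h.inCab,
    Fin 8, inferInstance, G1, inCab_G1, not_inCa_G1⟩
end

section
/- Let G be a finite simple graph with vertex set V equipped with a grounded segment representation: an injective function g : V → ℝ and, for each vertex v, a closed line segment σ_v ⊆ ℝ × [0, ∞) having (g(v), 0) as one of its endpoints, such that no point of the x-axis belongs to two distinct segments, and two distinct vertices u, v are adjacent in G if and only if σ_u ∩ σ_v ≠ ∅. Then G admits a grounded stairs representation: there exist an injective function g' : V → ℝ and, for each vertex v, a continuous curve γ_v : [0,1] → ℝ × [0, ∞) whose two coordinate functions are both monotone nondecreasing, with γ_v(0) = (g'(v), 0), such that no point of the x-axis belongs to the images of two distinct curves, and two distinct vertices u, v are adjacent in G if and only if the images of γ_u and γ_v intersect. In particular, every grounded segment graph is a grounded stairs graph. -/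
/-- A straight-line curve from `(a, 0)`: the image of the segment to `q` under the horizontal shear
`(x, y) ↦ (x + M * y, y)`, shrunk to a point when the segment is horizontal. -/
noncomputable def shearedCurve (M a : ℝ) (q : ℝ × ℝ) (t : ℝ) : ℝ × ℝ :=
  if q.2 = 0 then (a, 0) else (a + t * (q.1 - a + M * q.2), t * q.2)

theorem mem_segment_of_mem_image_shearedCurve {M a : ℝ} {q p : ℝ × ℝ}
    (hp : p ∈ shearedCurve M a q '' Set.Icc (0 : ℝ) 1) :
    (p.1 - M * p.2, p.2) ∈ segment ℝ (a, (0 : ℝ)) q := by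
  obtain ⟨t, ht, rfl⟩ := hp
  by_cases h : q.2 = 0
  · simpa [shearedCurve, h] using left_mem_segment ℝ (a, (0 : ℝ)) q
  · rw [segment_eq_image']
    refine ⟨t, ht, ?_⟩
    ext
    · simp [shearedCurve, h]
      ring
    · simp [shearedCurve, h]

theorem mem_image_shearedCurve_of_mem_segment {M a : ℝ} {q p : ℝ × ℝ}
    (hp : p ∈ segment ℝ (a, (0 : ℝ)) q) (hp2 : p.2 ≠ 0) :
    (p.1 + M * p.2, p.2) ∈ shearedCurve M a q '' Set.Icc (0 : ℝ) 1 := by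
  rw [segment_eq_image'] at hp
  obtain ⟨t, ht, rfl⟩ := hp
  have h : q.2 ≠ 0 := by
    intro h
    simp [h] at hp2
  refine ⟨t, ht, ?_⟩
  ext
  · simp [shearedCurve, h]
    ring
  · simp [shearedCurve, h]

theorem continuous_shearedCurve (M a : ℝ) (q : ℝ × ℝ) : Continuous (shearedCurve M a q) := by
  unfold shearedCurve
  split_ifs <;> fun_prop

theorem monotone_shearedCurve_fst {M a : ℝ} {q : ℝ × ℝ}
    (h : q.2 ≠ 0 → 0 ≤ q.1 - a + M * q.2) : Monotone fun t => (shearedCurve M a q t).1 := by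
  intro s t hst
  by_cases hq : q.2 = 0
  · simp [shearedCurve, hq]
  · simpa [shearedCurve, hq] using mul_le_mul_of_nonneg_right hst (h hq)

theorem monotone_shearedCurve_snd {M a : ℝ} {q : ℝ × ℝ} (h : 0 ≤ q.2) :
    Monotone fun t => (shearedCurve M a q t).2 := by
  intro s t hst
  by_cases hq : q.2 = 0
  · simp [shearedCurve, hq]
  · simpa [shearedCurve, hq] using mul_le_mul_of_nonneg_right hst h

theorem shearedCurve_zero (M a : ℝ) (q : ℝ × ℝ) : shearedCurve M a q 0 = (a, 0) := by
  simp [shearedCurve]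

/-- Finitely many non-horizontal directions can be sheared to point weakly to the right. -/
theorem exists_shear_nonneg {V : Type*} [Fintype V] (d h : V → ℝ) (hh : ∀ v, 0 ≤ h v) :
    ∃ M : ℝ, ∀ v, h v ≠ 0 → 0 ≤ d v + M * h v := by
  refine ⟨∑ v, |d v| / h v, fun v hv => ?_⟩
  have hle : |d v| / h v ≤ ∑ v, |d v| / h v :=
    Finset.single_le_sum (f := fun v => |d v| / h v)
      (fun w _ => div_nonneg (abs_nonneg _) (hh w)) (Finset.mem_univ v)
  have hpos : 0 < h v := lt_of_le_of_ne (hh v) hv.symm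
  rw [div_le_iff₀ hpos] at hle
  linarith [neg_abs_le (d v)]

/-- Every grounded segment graph is a grounded stairs graph. -/
theorem grounded_segment_is_grounded_stairs
    {V : Type*} [Fintype V] (G : SimpleGraph V)
    (g : V → ℝ) (q : V → ℝ × ℝ)
    (hg : Function.Injective g)
    (hupper : ∀ v, ∀ p ∈ segment ℝ ((g v : ℝ), (0 : ℝ)) (q v), 0 ≤ p.2)
    (haxis : ∀ u v, u ≠ v → ∀ p : ℝ × ℝ,
      p ∈ segment ℝ ((g u : ℝ), (0 : ℝ)) (q u) →
      p ∈ segment ℝ ((g v : ℝ), (0 : ℝ)) (q v) → p.2 ≠ 0)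
    (hadj : ∀ u v, u ≠ v → (G.Adj u v ↔
      (segment ℝ ((g u : ℝ), (0 : ℝ)) (q u) ∩
        segment ℝ ((g v : ℝ), (0 : ℝ)) (q v)).Nonempty)) :
    ∃ (g' : V → ℝ) (γ : V → ℝ → ℝ × ℝ),
      Function.Injective g' ∧
      (∀ v, ContinuousOn (γ v) (Set.Icc 0 1)) ∧
      (∀ v, MonotoneOn (fun t => (γ v t).1) (Set.Icc 0 1)) ∧
      (∀ v, MonotoneOn (fun t => (γ v t).2) (Set.Icc 0 1)) ∧
      (∀ v, ∀ t ∈ Set.Icc (0 : ℝ) 1, 0 ≤ (γ v t).2) ∧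
      (∀ v, γ v 0 = (g' v, 0)) ∧
      (∀ u v, u ≠ v →
        ∀ p ∈ γ u '' Set.Icc (0 : ℝ) 1 ∩ γ v '' Set.Icc (0 : ℝ) 1, p.2 ≠ 0) ∧
      (∀ u v, u ≠ v →
        (G.Adj u v ↔ (γ u '' Set.Icc (0 : ℝ) 1 ∩ γ v '' Set.Icc (0 : ℝ) 1).Nonempty)) := by
  have hq : ∀ v, 0 ≤ (q v).2 := fun v => hupper v _ (right_mem_segment ℝ _ _)
  obtain ⟨M, hM⟩ := exists_shear_nonneg (fun v => (q v).1 - g v) (fun v => (q v).2) hq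
  refine ⟨g, fun v => shearedCurve M (g v) (q v), hg,
    fun v => (continuous_shearedCurve _ _ _).continuousOn,
    fun v => (monotone_shearedCurve_fst (hM v)).monotoneOn _,
    fun v => (monotone_shearedCurve_snd (hq v)).monotoneOn _, ?_,
    fun v => shearedCurve_zero _ _ _, ?_, ?_⟩
  · intro v t ht
    simpa [shearedCurve_zero] using monotone_shearedCurve_snd (M := M) (a := g v) (hq v) ht.1
  · rintro u v huv p ⟨hu, hv⟩
    exact haxis u v huv (p.1 - M * p.2, p.2) (mem_segment_of_mem_image_shearedCurve hu)
      (mem_segment_of_mem_image_shearedCurve hv)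
  · intro u v huv
    rw [hadj u v huv]
    constructor
    · rintro ⟨p, hu, hv⟩
      have hp := haxis u v huv p hu hv
      exact ⟨_, mem_image_shearedCurve_of_mem_segment hu hp,
        mem_image_shearedCurve_of_mem_segment hv hp⟩
    · rintro ⟨p, hu, hv⟩
      exact ⟨_, mem_segment_of_mem_image_shearedCurve hu,
        mem_segment_of_mem_image_shearedCurve hv⟩
end
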